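/- Let a ≥ 3 and b, c ≥ 1 be integers, and let i, j be integers with 2 ≤ i, j ≤ a−1. Denote by OPP(a,b,c)_{i,j} the number of lozenge tilings of the hexagon H_{a,b,c} with two dents of opposite orientation removed in positions i and j along the two opposite sides of length a, where position i is counted from the common vertex of its side with the adjacent side of length b and position j is counted from the common vertex of its side with the adjacent side of length c. Then OPP(a,b,c)_{i,j} · OPP(a−2,b,c)_{i−1,j−1} = OPP(a−1,b,c)_{i−1,j−1} · OPP(a−1,b,c)_{i,j} − OPP(a−1,b−1,c+1)_{i,j−1} · OPP(a−1,b+1,c−1)_{i−1,j}. -/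

import Mathlib

/-- A unit triangle of the triangular lattice, encoded as `(x, y, ε)` where
`ε = true` means up-pointing and `ε = false` means down-pointing. -/
abbrev Tri : Type := ℤ × ℤ × Bool

/-- Two unit triangles are adjacent (i.e. together they form a lozenge) iff one of them is
the up-triangle at `(x,y)` and the other is one of the down-triangles at
`(x,y)`, `(x-1,y)`, `(x,y-1)`. -/
def Adj (s t : Tri) : Prop :=
  ∃ x y : ℤ,
    ({s, t} : Set Tri) = {(x, y, true), (x, y, false)} ∨
    ({s, t} : Set Tri) = {(x, y, true), (x - 1, y, false)} ∨
    ({s, t} : Set Tri) = {(x, y, true), (x, y - 1, false)}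

/-- `P` is a lozenge tiling of the region `R`: a partition of `R` into pairs of
adjacent unit triangles. -/
def IsLozengeTiling (R : Set Tri) (P : Set (Set Tri)) : Prop :=
  (∀ L ∈ P, ∃ s t : Tri, Adj s t ∧ L = {s, t}) ∧
  (∀ L ∈ P, L ⊆ R) ∧
  (∀ r ∈ R, ∃! L, L ∈ P ∧ r ∈ L)

/-- The number of lozenge tilings of the region `R`. -/
noncomputable def M (R : Set Tri) : ℕ :=
  Nat.card {P : Set (Set Tri) // IsLozengeTiling R P}

/-- The hexagonal region `H^k_{a,b,c}` on the triangular lattice, whose side lengths in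
clockwise order starting from the top side are `a, b+k, c, a+k, b, c+k`.
(Concretely: the unit triangles all of whose vertices `(x,y)` satisfy
`0 ≤ x ≤ a+b+k`, `0 ≤ y ≤ b+c+k`, `b ≤ x+y ≤ a+b+c+k`.) -/
def HexK (a b c k : ℕ) : Set Tri :=
  {t | 0 ≤ t.1 ∧ t.1 ≤ (a : ℤ) + b + k - 1 ∧ 0 ≤ t.2.1 ∧ t.2.1 ≤ (b : ℤ) + c + k - 1 ∧
    (if t.2.2 then (b : ℤ) ≤ t.1 + t.2.1 ∧ t.1 + t.2.1 ≤ (a : ℤ) + b + c + k - 1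
     else (b : ℤ) - 1 ≤ t.1 + t.2.1 ∧ t.1 + t.2.1 ≤ (a : ℤ) + b + c + k - 2)}

/-- The hexagonal region `H_{a,b,c}` whose side lengths in clockwise order starting from
the top side are `a, b, c, a, b, c`. -/
def Hex (a b c : ℕ) : Set Tri := HexK a b c 0

/-- `OPP(a,b,c)_{i,j}`: the number of lozenge tilings of the hexagon `H_{a,b,c}` with two
dents of opposite orientation removed in positions `i` and `j` along the two opposite
sides of length `a`, where position `i` is counted from the common vertex of its side with
the adjacent side of length `b` and position `j` from the common vertex of its side with
the adjacent side of length `c`: the up-pointing triangle `(b+i-1, 0)` on the southern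
side and the down-pointing triangle `(j-1, b+c-1)` on the northern side. -/
noncomputable def OPP (a b c i j : ℕ) : ℕ :=
  M (Hex a b c \ {((b : ℤ) + i - 1, 0, true), ((j : ℤ) - 1, (b : ℤ) + c - 1, false)})

namespace Matrix

/-- The inclusion of the interior indices of `Fin (m + 2)` together with the two extreme ones. -/
def innerExtremes (m : ℕ) : Fin m ⊕ Fin 2 → Fin (m + 2) :=
  Sum.elim (fun k => k.succ.castSucc) ![0, Fin.last (m + 1)]

theorem innerExtremes_bijective (m : ℕ) : Function.Bijective (innerExtremes m) := by
  rw [Fintype.bijective_iff_injective_and_card]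
  refine ⟨?_, by simp⟩
  rintro (k | k) (l | l) h
  · simpa [innerExtremes] using h
  · fin_cases l
    · simp [innerExtremes, Fin.ext_iff] at h
    · have := k.2
      simp [innerExtremes, Fin.ext_iff] at h
      omega
  · fin_cases k
    · simp [innerExtremes, Fin.ext_iff] at h
    · have := l.2
      simp [innerExtremes, Fin.ext_iff] at h
      omega
  · fin_cases k <;> fin_cases l <;> simp [innerExtremes, Fin.ext_iff] at h ⊢

/-- A `2 × 2` minor of the adjugate, multiplied by the determinant. -/
theorem det_mul_det_adjugate_toBlocks₂₂ {R n m : Type*} [CommRing R] [Fintype n] [DecidableEq n]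
    [Fintype m] [DecidableEq m] (A : Matrix (n ⊕ m) (n ⊕ m) R) :
    A.det * A.adjugate.toBlocks₂₂.det = A.toBlocks₁₁.det * A.det ^ Fintype.card m := by
  have h := mul_adjugate A
  have hA := fromBlocks_toBlocks A
  have hB := fromBlocks_toBlocks A.adjugate
  rw [← fromBlocks_one, fromBlocks_smul] at h
  nth_rewrite 1 [← hA] at h
  rw [← hB, fromBlocks_multiply, fromBlocks_inj] at h
  obtain ⟨-, h₁₂, -, h₂₂⟩ := h
  have key : A * fromBlocks 1 A.adjugate.toBlocks₁₂ 0 A.adjugate.toBlocks₂₂ =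
      fromBlocks A.toBlocks₁₁ 0 A.toBlocks₂₁ (A.det • 1) := by
    nth_rewrite 1 [← hA]
    rw [fromBlocks_multiply, h₁₂, h₂₂]
    simp
  have := congrArg det key
  rwa [det_mul, det_fromBlocks_zero₂₁, det_one, one_mul, det_fromBlocks_zero₁₂, det_smul,
    det_one, mul_one] at this

/-- The **Desnanot–Jacobi identity** for a matrix whose determinant is not a zero divisor. -/
theorem desnanot_jacobi_of_det_ne_zero {R : Type*} [CommRing R] [IsDomain R] {m : ℕ}
    (A : Matrix (Fin (m + 2)) (Fin (m + 2)) R) (hA : A.det ≠ 0) :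
    A.det * (A.submatrix (fun k : Fin m => k.succ.castSucc) (fun k => k.succ.castSucc)).det =
      (A.submatrix Fin.succ Fin.succ).det * (A.submatrix Fin.castSucc Fin.castSucc).det -
      (A.submatrix Fin.succ Fin.castSucc).det * (A.submatrix Fin.castSucc Fin.succ).det := by
  let e := Equiv.ofBijective _ (innerExtremes_bijective m)
  have h := det_mul_det_adjugate_toBlocks₂₂ (A.submatrix e e)
  rw [adjugate_submatrix_equiv_self, det_submatrix_equiv_self, Fintype.card_fin, pow_two,
    mul_left_comm] at h
  have h := mul_left_cancel₀ hA h
  rw [det_fin_two] at h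
  have e0 : e (Sum.inr 0) = 0 := rfl
  have e1 : e (Sum.inr 1) = Fin.last (m + 1) := rfl
  simp only [toBlocks₂₂, of_apply, submatrix_apply, e0, e1,
    adjugate_fin_succ_eq_det_submatrix] at h
  have hl : (Fin.last (m + 1)).succAbove = Fin.castSucc := by
    ext k; simp
  have hz : (0 : Fin (m + 2)).succAbove = Fin.succ := by
    ext k; simp
  rw [hl, hz] at h
  have hs : ((-1 : R) ^ (m + 1)) * (-1) ^ (m + 1) = 1 := by
    rw [← mul_pow]; simp
  have hs' : ((-1 : R) ^ (m + 1 + (m + 1))) = 1 := by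
    rw [pow_add, hs]
  simp only [Fin.val_zero, Fin.val_last, add_zero, zero_add, pow_zero, one_mul, hs'] at h
  have hP : (A.submatrix e e).toBlocks₁₁ =
      A.submatrix (fun k : Fin m => k.succ.castSucc) (fun k => k.succ.castSucc) := rfl
  rw [hP] at h
  linear_combination -h - (A.submatrix Fin.castSucc Fin.succ).det *
    (A.submatrix Fin.succ Fin.castSucc).det * hs

/-- The **Desnanot–Jacobi identity** (Dodgson condensation). -/
theorem desnanot_jacobi {R : Type*} [CommRing R] {m : ℕ}
    (A : Matrix (Fin (m + 2)) (Fin (m + 2)) R) :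
    A.det * (A.submatrix (fun k : Fin m => k.succ.castSucc) (fun k => k.succ.castSucc)).det =
      (A.submatrix Fin.succ Fin.succ).det * (A.submatrix Fin.castSucc Fin.castSucc).det -
      (A.submatrix Fin.succ Fin.castSucc).det * (A.submatrix Fin.castSucc Fin.succ).det := by
  have h := desnanot_jacobi_of_det_ne_zero _ (det_mvPolynomialX_ne_zero (Fin (m + 2)) ℤ)
  have h := congrArg (MvPolynomial.eval₂Hom (Int.castRingHom R) fun p => A p.1 p.2) h
  have hX : (MvPolynomial.eval₂Hom (Int.castRingHom R) fun p => A p.1 p.2).mapMatrix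
      (mvPolynomialX (Fin (m + 2)) (Fin (m + 2)) ℤ) = A := mvPolynomialX_map_eval₂ _ A
  have hS (f g : Fin (m + 1) → Fin (m + 2)) :
      (MvPolynomial.eval₂Hom (Int.castRingHom R) fun p => A p.1 p.2).mapMatrix
      ((mvPolynomialX (Fin (m + 2)) (Fin (m + 2)) ℤ).submatrix f g) = A.submatrix f g := by
    conv_rhs => rw [← hX]
    rfl
  have hS' (f g : Fin m → Fin (m + 2)) :
      (MvPolynomial.eval₂Hom (Int.castRingHom R) fun p => A p.1 p.2).mapMatrix
      ((mvPolynomialX (Fin (m + 2)) (Fin (m + 2)) ℤ).submatrix f g) = A.submatrix f g := by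
    conv_rhs => rw [← hX]
    rfl
  simpa only [map_mul, map_sub, RingHom.map_det, hX, hS, hS'] using h

end Matrix

namespace IsLozengeTiling

variable {R : Set Tri} {P : Set (Set Tri)}

theorem exists_partner (hP : IsLozengeTiling R P) {r : Tri} (hr : r ∈ R) :
    ∃ t ∈ R, Adj r t ∧ {r, t} ∈ P := by
  obtain ⟨L, ⟨hL, hrL⟩, -⟩ := hP.2.2 r hr
  obtain ⟨s, t, hst, rfl⟩ := hP.1 L hL
  have hsub := hP.2.1 _ hL
  rcases hrL with rfl | rfl
  · exact ⟨t, hsub (by simp), hst, hL⟩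
  · refine ⟨s, hsub (by simp), ?_, ?_⟩
    · simpa only [Adj, Set.pair_comm] using hst
    · rwa [Set.pair_comm]

theorem eq_of_mem (hP : IsLozengeTiling R P) {L L' : Set Tri} (hL : L ∈ P) (hL' : L' ∈ P)
    {r : Tri} (h : r ∈ L) (h' : r ∈ L') : L = L' :=
  (hP.2.2 r (hP.2.1 L hL h)).unique ⟨hL, h⟩ ⟨hL', h'⟩

theorem partner_unique (hP : IsLozengeTiling R P) {r t t' : Tri} (ht : {r, t} ∈ P)
    (ht' : {r, t'} ∈ P) : t = t' := by
  have h := hP.eq_of_mem ht ht' (r := r) (by simp) (by simp)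
  have h1 : t ∈ ({r, t'} : Set Tri) := h ▸ (by simp)
  have h2 : t' ∈ ({r, t} : Set Tri) := h ▸ (by simp)
  rcases h1 with h1 | h1
  · rcases h2 with h2 | h2
    · rw [h1, h2]
    · exact h2.symm
  · exact h1

theorem nonempty_of_mem (hP : IsLozengeTiling R P) {L : Set Tri} (hL : L ∈ P) : L.Nonempty := by
  obtain ⟨s, t, -, rfl⟩ := hP.1 L hL
  exact ⟨s, by simp⟩

theorem union {A B : Set Tri} {F Q : Set (Set Tri)} (hF : IsLozengeTiling A F)
    (hQ : IsLozengeTiling B Q) (hAB : Disjoint A B) : IsLozengeTiling (A ∪ B) (F ∪ Q) := by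
  refine ⟨?_, ?_, ?_⟩
  · rintro L (h | h)
    exacts [hF.1 L h, hQ.1 L h]
  · rintro L (h | h)
    exacts [(hF.2.1 L h).trans Set.subset_union_left, (hQ.2.1 L h).trans Set.subset_union_right]
  · rintro r (hr | hr)
    · obtain ⟨L, ⟨hL, hrL⟩, hu⟩ := hF.2.2 r hr
      refine ⟨L, ⟨Or.inl hL, hrL⟩, ?_⟩
      rintro L' ⟨h | h, hr'⟩
      · exact hu L' ⟨h, hr'⟩
      · exact (Set.disjoint_left.1 hAB hr (hQ.2.1 L' h hr')).elim
    · obtain ⟨L, ⟨hL, hrL⟩, hu⟩ := hQ.2.2 r hr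
      refine ⟨L, ⟨Or.inr hL, hrL⟩, ?_⟩
      rintro L' ⟨h | h, hr'⟩
      · exact (Set.disjoint_left.1 hAB (hF.2.1 L' h hr') hr).elim
      · exact hu L' ⟨h, hr'⟩

theorem sdiff {A : Set Tri} {F : Set (Set Tri)} (hP : IsLozengeTiling R P)
    (hF : IsLozengeTiling A F) (hFP : F ⊆ P) : IsLozengeTiling (R \ A) (P \ F) := by
  refine ⟨fun L hL => hP.1 L hL.1, fun L hL r hr => ⟨hP.2.1 L hL.1 hr, fun hA => ?_⟩, ?_⟩
  · obtain ⟨L', ⟨hL', hrL'⟩, -⟩ := hF.2.2 r hA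
    exact hL.2 (hP.eq_of_mem hL.1 (hFP hL') hr hrL' ▸ hL')
  · rintro r ⟨hr, hA⟩
    obtain ⟨L, ⟨hL, hrL⟩, hu⟩ := hP.2.2 r hr
    exact ⟨L, ⟨⟨hL, fun h => hA (hF.2.1 L h hrL)⟩, hrL⟩, fun L' h => hu L' ⟨h.1.1, h.2⟩⟩

theorem sUnion_of_pairwiseDisjoint {F : Set (Set Tri)} (hF : ∀ L ∈ F, ∃ s t, Adj s t ∧ L = {s, t})
    (hd : ∀ L ∈ F, ∀ L' ∈ F, ∀ r ∈ L, r ∈ L' → L = L') : IsLozengeTiling (⋃₀ F) F := by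
  refine ⟨hF, fun L hL => Set.subset_sUnion_of_mem hL, ?_⟩
  rintro r ⟨L, hL, hr⟩
  exact ⟨L, ⟨hL, hr⟩, fun L' h => hd L' h.1 L hL r h.2 hr⟩

end IsLozengeTiling

theorem finite_lozengeTilings {R : Set Tri} (hR : R.Finite) :
    Finite {P : Set (Set Tri) // IsLozengeTiling R P} :=
  (hR.powerset.powerset.subset fun _ hP L hL => hP.2.1 L hL).to_subtype

/-- If every tiling of `R` contains exactly one of the partial tilings `F i`, then the tilings
of `R` are counted by the tilings of the complements of the regions covered by the `F i`. -/
theorem M_eq_sum_of_existsUnique {ι : Type*} (I : Finset ι) {R : Set Tri} (hR : R.Finite)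
    (F : ι → Set (Set Tri)) (A : ι → Set Tri) (hA : ∀ i ∈ I, A i ⊆ R)
    (hF : ∀ i ∈ I, IsLozengeTiling (A i) (F i))
    (hex : ∀ P, IsLozengeTiling R P → ∃! i, i ∈ I ∧ F i ⊆ P) :
    M R = ∑ i ∈ I, M (R \ A i) := by
  have hfin (i : I) : Finite {Q : Set (Set Tri) // IsLozengeTiling (R \ A i) Q} :=
    finite_lozengeTilings hR.sdiff
  let φ : (Σ i : I, {Q : Set (Set Tri) // IsLozengeTiling (R \ A i) Q}) →
      {P : Set (Set Tri) // IsLozengeTiling R P} := fun q =>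
    ⟨F q.1 ∪ q.2.1, by
      have := (hF _ q.1.2).union q.2.2 Set.disjoint_sdiff_right
      rwa [Set.union_sdiff_cancel (hA _ q.1.2)] at this⟩
  have hφ : Function.Bijective φ := by
    constructor
    · rintro ⟨⟨i, hi⟩, Q, hQ⟩ ⟨⟨i', hi'⟩, Q', hQ'⟩ h
      have hP := (φ ⟨⟨i, hi⟩, Q, hQ⟩).2
      have h : F i ∪ Q = F i' ∪ Q' := congrArg Subtype.val h
      obtain rfl : i = i' := (hex _ hP).unique ⟨hi, Set.subset_union_left⟩
        ⟨hi', by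
          change F i' ⊆ F i ∪ Q
          rw [h]; exact Set.subset_union_left⟩
      have hdisj {Q} (hQ : IsLozengeTiling (R \ A i) Q) : Disjoint (F i) Q := by
        rw [Set.disjoint_left]
        intro L hL hL'
        obtain ⟨r, hr⟩ := (hF i hi).nonempty_of_mem hL
        exact (hQ.2.1 L hL' hr).2 ((hF i hi).2.1 L hL hr)
      obtain rfl : Q = Q' := by
        rw [← (hdisj hQ).symm.sdiff_eq_left, ← (hdisj hQ').symm.sdiff_eq_left,
          ← Set.union_sdiff_left, h, Set.union_sdiff_left]
      rfl
    · rintro ⟨P, hP⟩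
      obtain ⟨i, ⟨hi, hiP⟩, -⟩ := hex P hP
      exact ⟨⟨⟨i, hi⟩, P \ F i, hP.sdiff (hF i hi) hiP⟩,
        Subtype.ext (Set.union_sdiff_cancel hiP)⟩
  rw [M, ← Nat.card_congr (Equiv.ofBijective φ hφ), Nat.card_sigma, ← Finset.sum_coe_sort I]
  rfl

theorem M_empty : M ∅ = 1 := by
  rw [M, Nat.card_eq_one_iff_unique]
  constructor
  · constructor
    rintro ⟨P, hP⟩ ⟨P', hP'⟩
    have h {P} (hP : IsLozengeTiling ∅ P) : P = ∅ := by
      rw [Set.eq_empty_iff_forall_notMem]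
      intro L hL
      obtain ⟨r, hr⟩ := hP.nonempty_of_mem hL
      exact hP.2.1 L hL hr
    exact Subtype.ext ((h hP).trans (h hP').symm)
  · exact ⟨∅, by simp [IsLozengeTiling]⟩

theorem adj_up_iff {x y : ℤ} {t : Tri} : Adj (x, y, true) t ↔
    t = (x, y, false) ∨ t = (x - 1, y, false) ∨ t = (x, y - 1, false) := by
  constructor
  · rintro ⟨x', y', h | h | h⟩ <;> rw [Set.pair_eq_pair_iff] at h <;> grind
  · rintro (rfl | rfl | rfl) <;> exact ⟨x, y, by simp⟩

theorem adj_down_iff {x y : ℤ} {t : Tri} : Adj (x, y, false) t ↔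
    t = (x, y, true) ∨ t = (x + 1, y, true) ∨ t = (x, y + 1, true) := by
  constructor
  · rintro ⟨x', y', h | h | h⟩ <;> rw [Set.pair_eq_pair_iff] at h <;> grind
  · rintro (rfl | rfl | rfl)
    · exact ⟨x, y, Or.inl (Set.pair_comm _ _)⟩
    · exact ⟨x + 1, y, Or.inr (Or.inl (by rw [Set.pair_comm]; simp))⟩
    · exact ⟨x, y + 1, Or.inr (Or.inr (by rw [Set.pair_comm]; simp))⟩

section Strip

variable {n : ℕ}

/-- The region made of the rows `0, …, y - 1`, in which the horizontal unit segments of height `z`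
lie at the positions of `E z`, except that the down-pointing triangles of the last row are only
those at the positions `u k`. -/
def strip (E : ℤ → Set ℤ) (y : ℕ) (u : Fin n → ℤ) : Set Tri :=
  {t | 0 ≤ t.2.1 ∧ if t.2.2 then t.2.1 < y ∧ t.1 ∈ E t.2.1
    else t.2.1 + 1 < y ∧ t.1 ∈ E (t.2.1 + 1) ∨ t.2.1 + 1 = y ∧ t.1 ∈ Set.range u}

/-- The positions `u`, with those indexed by `ε` moved one unit to the right. -/
def shift (u : Fin n → ℤ) (ε : Finset (Fin n)) (k : Fin n) : ℤ := if k ∈ ε then u k + 1 else u k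

/-- The lozenges touching the row of height `y` when the down-pointing triangles `u k` of this row
are matched with the up-pointing triangles `shift u ε k`. -/
def rowLozenges (E : ℤ → Set ℤ) (y : ℕ) (u : Fin n → ℤ) (ε : Finset (Fin n)) : Set (Set Tri) :=
  {L | (∃ k, L = {(u k, (y : ℤ), false), (shift u ε k, (y : ℤ), true)}) ∨
    ∃ x ∈ E y \ Set.range (shift u ε), L = {(x, (y : ℤ), true), (x, (y : ℤ) - 1, false)}}

/-- The admissible displacements of the positions `u` in the row of height `y`. -/
def Admissible (E : ℤ → Set ℤ) (y : ℕ) (u : Fin n → ℤ) (ε : Finset (Fin n)) : Prop :=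
  Function.Injective (shift u ε) ∧ Set.range (shift u ε) ⊆ E y ∧
    (y = 0 → E 0 ⊆ Set.range (shift u ε))

theorem strip_zero (E : ℤ → Set ℤ) (u : Fin n → ℤ) : strip E 0 u = ∅ := by
  ext ⟨x, z, _ | _⟩ <;> simp [strip] <;> grind

theorem strip_finite {E : ℤ → Set ℤ} (hE : ∀ z, (E z).Finite) (y : ℕ) (u : Fin n → ℤ) :
    (strip E y u).Finite := by
  have hX : ((⋃ z ∈ Set.Icc (0 : ℤ) y, E z) ∪ Set.range u).Finite :=
    ((Set.finite_Icc _ _).biUnion fun z _ => hE z).union (Set.finite_range u)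
  refine (hX.prod ((Set.finite_Icc (0 : ℤ) y).prod (Set.finite_univ (α := Bool)))).subset ?_
  rintro ⟨x, z, _ | _⟩ h
  · simp only [strip, Set.mem_ofPred_eq, Bool.false_eq_true, if_false] at h
    obtain ⟨h0, h | h⟩ := h
    · refine ⟨Or.inl (Set.mem_biUnion (x := z + 1) ⟨by omega, by omega⟩ h.2), ⟨h0, ?_⟩, trivial⟩
      change z ≤ y
      omega
    · refine ⟨Or.inr h.2, ⟨h0, ?_⟩, trivial⟩
      change z ≤ y
      omega
  · simp only [strip, Set.mem_ofPred_eq, if_true] at h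
    exact ⟨Or.inl (Set.mem_biUnion (x := z) ⟨h.1, h.2.1.le⟩ h.2.2), ⟨h.1, h.2.1.le⟩, trivial⟩

theorem isLozengeTiling_rowLozenges (E : ℤ → Set ℤ) (y : ℕ) {u : Fin n → ℤ}
    (hu : Function.Injective u) {ε : Finset (Fin n)} (hε : Admissible E y u ε) :
    IsLozengeTiling (⋃₀ rowLozenges E y u ε) (rowLozenges E y u ε) := by
  apply IsLozengeTiling.sUnion_of_pairwiseDisjoint
  · rintro L (⟨k, rfl⟩ | ⟨x, -, rfl⟩)
    · refine ⟨_, _, adj_down_iff.2 ?_, rfl⟩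
      unfold shift
      split_ifs <;> simp
    · exact ⟨_, _, adj_up_iff.2 (by simp), rfl⟩
  · have hi := hε.1
    rintro L (⟨k, rfl⟩ | ⟨x, hx, rfl⟩) L' (⟨l, rfl⟩ | ⟨x', hx', rfl⟩) r hr hr'
    · obtain rfl : k = l := by
        rcases hr with rfl | rfl <;> rcases hr' with h | h <;>
          simp only [Set.mem_singleton_iff, Prod.mk.injEq, Bool.true_eq_false, Bool.false_eq_true,
            and_false, and_true] at h
        · exact hu h
        · exact hi h
      rfl
    · rcases hr with rfl | rfl <;> rcases hr' with h | h <;>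
        simp only [Set.mem_singleton_iff, Prod.mk.injEq, Bool.true_eq_false, Bool.false_eq_true,
          and_false, and_true] at h
      · omega
      · exact (hx'.2 ⟨k, h⟩).elim
    · rcases hr with rfl | rfl <;> rcases hr' with h | h <;>
        simp only [Set.mem_singleton_iff, Prod.mk.injEq, Bool.true_eq_false, Bool.false_eq_true,
          and_false, and_true] at h
      · exact (hx.2 ⟨l, h.symm⟩).elim
      · omega
    · rcases hr with rfl | rfl <;> rcases hr' with h | h <;>
        simp only [Set.mem_singleton_iff, Prod.mk.injEq, Bool.true_eq_false, Bool.false_eq_true,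
          and_false, and_true] at h <;> rw [h]

theorem mem_sUnion_rowLozenges_up {E : ℤ → Set ℤ} {y : ℕ} {u : Fin n → ℤ} {ε : Finset (Fin n)}
    (hε : Admissible E y u ε) {x z : ℤ} :
    (x, z, true) ∈ ⋃₀ rowLozenges E y u ε ↔ z = y ∧ x ∈ E y := by
  constructor
  · rintro ⟨L, ⟨k, rfl⟩ | ⟨x', hx, rfl⟩, h⟩
    · simp only [Set.mem_insert_iff, Set.mem_singleton_iff, Prod.mk.injEq, Bool.true_eq_false,
        and_false, and_true, false_or] at h
      exact ⟨h.2, h.1 ▸ hε.2.1 ⟨k, rfl⟩⟩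
    · simp only [Set.mem_insert_iff, Set.mem_singleton_iff, Prod.mk.injEq, Bool.true_eq_false,
        and_false, and_true, or_false] at h
      exact ⟨h.2, h.1 ▸ hx.1⟩
  · rintro ⟨rfl, hx⟩
    by_cases h : x ∈ Set.range (shift u ε)
    · obtain ⟨k, rfl⟩ := h
      exact ⟨_, Or.inl ⟨k, rfl⟩, by simp⟩
    · exact ⟨_, Or.inr ⟨x, ⟨hx, h⟩, rfl⟩, by simp⟩

theorem mem_sUnion_rowLozenges_down {E : ℤ → Set ℤ} {y : ℕ} {u : Fin n → ℤ} {ε : Finset (Fin n)}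
    {x z : ℤ} : (x, z, false) ∈ ⋃₀ rowLozenges E y u ε ↔
      z = y ∧ x ∈ Set.range u ∨ z = y - 1 ∧ x ∈ E y \ Set.range (shift u ε) := by
  constructor
  · rintro ⟨L, ⟨k, rfl⟩ | ⟨x', hx, rfl⟩, h⟩
    · simp only [Set.mem_insert_iff, Set.mem_singleton_iff, Prod.mk.injEq, Bool.false_eq_true,
        and_false, and_true, or_false] at h
      exact Or.inl ⟨h.2, k, h.1.symm⟩
    · simp only [Set.mem_insert_iff, Set.mem_singleton_iff, Prod.mk.injEq, Bool.false_eq_true,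
        and_false, and_true, false_or] at h
      exact Or.inr ⟨h.2, h.1 ▸ hx⟩
  · rintro (⟨rfl, k, rfl⟩ | ⟨rfl, hx⟩)
    · exact ⟨_, Or.inl ⟨k, rfl⟩, by simp⟩
    · exact ⟨_, Or.inr ⟨x, hx, rfl⟩, by simp⟩

theorem sUnion_rowLozenges_subset {E : ℤ → Set ℤ} {y : ℕ} {u : Fin n → ℤ} {ε : Finset (Fin n)}
    (hε : Admissible E y u ε) : ⋃₀ rowLozenges E y u ε ⊆ strip E (y + 1) u := by
  rintro ⟨x, z, _ | _⟩ h
  · rw [mem_sUnion_rowLozenges_down] at h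
    simp only [strip, Set.mem_ofPred_eq, Bool.false_eq_true, if_false]
    push_cast
    obtain ⟨rfl, h⟩ | ⟨rfl, h⟩ := h
    · exact ⟨by positivity, Or.inr ⟨rfl, h⟩⟩
    · have : y ≠ 0 := by
        rintro rfl
        exact h.2 (hε.2.2 rfl h.1)
      refine ⟨by omega, Or.inl ⟨by omega, ?_⟩⟩
      rw [sub_add_cancel]
      exact h.1
  · rw [mem_sUnion_rowLozenges_up hε] at h
    obtain ⟨rfl, h⟩ := h
    simp only [strip, Set.mem_ofPred_eq, if_true]
    push_cast
    exact ⟨by positivity, by omega, h⟩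

theorem strip_diff_rowLozenges {E : ℤ → Set ℤ} {y : ℕ} {u : Fin n → ℤ} {ε : Finset (Fin n)}
    (hε : Admissible E y u ε) :
    strip E (y + 1) u \ ⋃₀ rowLozenges E y u ε = strip E y (shift u ε) := by
  ext ⟨x, z, _ | _⟩
  · rw [Set.mem_sdiff, mem_sUnion_rowLozenges_down]
    simp only [strip, Set.mem_ofPred_eq, Bool.false_eq_true, if_false]
    push_cast
    rcases lt_trichotomy (z + 1) (y : ℤ) with h | h | h
    · have h1 : z ≠ y := by omega
      have h2 : z ≠ y - 1 := by omega
      simp [h, h1, h2, h.ne, h.trans (lt_add_one _)]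
    · obtain rfl : z = y - 1 := by omega
      have h3 := @hε.2.1 x
      simp only [sub_add_cancel, lt_irrefl, false_and, false_or, true_and, lt_add_one]
      have h1 : (y : ℤ) - 1 ≠ y := by omega
      have h2 : (y : ℤ) ≠ y + 1 := by omega
      simp only [h1, h2, false_and, or_false, false_or, Set.mem_sdiff]
      tauto
    · have h1 : ¬ z + 1 < (y : ℤ) := by omega
      have h2 : z + 1 ≠ (y : ℤ) := by omega
      have h3 : ¬ z + 1 < (y : ℤ) + 1 := by omega
      have h4 : z + 1 = (y : ℤ) + 1 ↔ z = y := by omega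
      simp only [h1, h2, h3, h4, false_and, or_false, false_or]
      tauto
  · rw [Set.mem_sdiff, mem_sUnion_rowLozenges_up hε]
    simp only [strip, Set.mem_ofPred_eq, if_true]
    push_cast
    constructor
    · rintro ⟨⟨h0, h1, h2⟩, h3⟩
      have : z ≠ y := by
        rintro rfl
        exact h3 ⟨rfl, h2⟩
      exact ⟨h0, by omega, h2⟩
    · rintro ⟨h0, h1, h2⟩
      exact ⟨⟨h0, by omega, h2⟩, by omega⟩

theorem existsUnique_rowLozenges_subset (E : ℤ → Set ℤ) (y : ℕ) {u : Fin n → ℤ}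
    (hu : Function.Injective u) {P : Set (Set Tri)} (hP : IsLozengeTiling (strip E (y + 1) u) P) :
    ∃! ε, Admissible E y u ε ∧ rowLozenges E y u ε ⊆ P := by
  classical
  let ε : Finset (Fin n) :=
    {k | ({(u k, (y : ℤ), false), (u k + 1, (y : ℤ), true)} : Set Tri) ∈ P}
  have hup {x z : ℤ} : (x, z, true) ∈ strip E (y + 1) u ↔ 0 ≤ z ∧ z < y + 1 ∧ x ∈ E z := by
    simp [strip]
  have hdown {x z : ℤ} : (x, z, false) ∈ strip E (y + 1) u ↔
      0 ≤ z ∧ (z + 1 < y + 1 ∧ x ∈ E (z + 1) ∨ z + 1 = y + 1 ∧ x ∈ Set.range u) := by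
    simp [strip]
  have hmem (k : Fin n) :
      ({(u k, (y : ℤ), false), (shift u ε k, (y : ℤ), true)} : Set Tri) ∈ P := by
    obtain ⟨t, htR, hadj, ht⟩ := hP.exists_partner (r := (u k, (y : ℤ), false))
      (hdown.2 ⟨by positivity, Or.inr ⟨rfl, k, rfl⟩⟩)
    rcases adj_down_iff.1 hadj with rfl | rfl | rfl
    · have : k ∉ ε := by
        intro h
        have := hP.partner_unique ht (Finset.mem_filter.1 h).2
        simp at this
      simpa [shift, this] using ht
    · have : k ∈ ε := Finset.mem_filter.2 ⟨Finset.mem_univ _, ht⟩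
      simpa [shift, this] using ht
    · have := (hup.1 htR).2.1
      omega
  have hvert {x : ℤ} (hx : x ∈ E y \ Set.range (shift u ε)) : y ≠ 0 ∧
      ({(x, (y : ℤ), true), (x, (y : ℤ) - 1, false)} : Set Tri) ∈ P := by
    obtain ⟨t, htR, hadj, ht⟩ := hP.exists_partner (r := (x, (y : ℤ), true))
      (hup.2 ⟨by positivity, by omega, hx.1⟩)
    have hcontra {x' : ℤ} (hR : (x', (y : ℤ), false) ∈ strip E (y + 1) u)
        (h : ({(x, (y : ℤ), true), (x', (y : ℤ), false)} : Set Tri) ∈ P) : False := by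
      obtain ⟨-, h' | ⟨-, k, rfl⟩⟩ := hdown.1 hR
      · omega
      · rw [Set.pair_comm] at h
        have := hP.partner_unique h (hmem k)
        simp only [Prod.mk.injEq, and_true] at this
        exact hx.2 ⟨k, this.symm⟩
    rcases adj_up_iff.1 hadj with rfl | rfl | rfl
    · exact (hcontra htR ht).elim
    · exact (hcontra htR ht).elim
    · refine ⟨?_, ht⟩
      have := (hdown.1 htR).1
      omega
  refine ⟨ε, ⟨⟨fun k l h => ?_, ?_, ?_⟩, ?_⟩, ?_⟩
  · have h1 := hmem k
    have h2 := hmem l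
    rw [← h, Set.pair_comm] at h2
    rw [Set.pair_comm] at h1
    have := hP.partner_unique h1 h2
    simp only [Prod.mk.injEq, and_true] at this
    exact hu this
  · rintro _ ⟨k, rfl⟩
    exact (hup.1 (hP.2.1 _ (hmem k) (by simp))).2.2
  · rintro rfl x hx
    by_contra h
    exact (hvert ⟨hx, h⟩).1 rfl
  · rintro L (⟨k, rfl⟩ | ⟨x, hx, rfl⟩)
    exacts [hmem k, (hvert hx).2]
  · rintro ε' ⟨-, hε'⟩
    ext k
    have := hP.partner_unique (hmem k) (hε' (Or.inl ⟨k, rfl⟩))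
    simp only [Prod.mk.injEq, and_true, shift] at this
    split_ifs at this with h1 h2 h2 <;> first | omega | simp [h1, h2]

open Classical in
theorem M_strip_succ {E : ℤ → Set ℤ} (hE : ∀ z, (E z).Finite) (y : ℕ) {u : Fin n → ℤ}
    (hu : Function.Injective u) :
    M (strip E (y + 1) u) =
      ∑ ε : Finset (Fin n) with Admissible E y u ε, M (strip E y (shift u ε)) := by
  rw [M_eq_sum_of_existsUnique ({ε | Admissible E y u ε} : Finset (Finset (Fin n)))
    (strip_finite hE _ u) (rowLozenges E y u) (fun ε => ⋃₀ rowLozenges E y u ε)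
    (fun ε hε => sUnion_rowLozenges_subset (Finset.mem_filter.1 hε).2)
    (fun ε hε => isLozengeTiling_rowLozenges E y hu (Finset.mem_filter.1 hε).2)
    (fun P hP => by simpa using existsUnique_rowLozenges_subset E y hu hP)]
  refine Finset.sum_congr rfl fun ε hε => ?_
  rw [strip_diff_rowLozenges (Finset.mem_filter.1 hε).2]

/-- The binomial coefficient `y.choose d`, extended by zero to negative `d`. -/
def intChoose (y : ℕ) (d : ℤ) : ℤ := if 0 ≤ d then y.choose d.toNat else 0

theorem intChoose_succ (y : ℕ) (d : ℤ) :
    intChoose (y + 1) d = intChoose y (d - 1) + intChoose y d := by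
  unfold intChoose
  rcases lt_trichotomy d 0 with h | rfl | h
  · rw [if_neg (by omega), if_neg (by omega), if_neg (by omega), add_zero]
  · simp
  · obtain ⟨e, rfl⟩ : ∃ e : ℕ, d = e + 1 := ⟨(d - 1).toNat, by omega⟩
    rw [if_pos (by omega), if_pos (by omega), if_pos (by omega)]
    have : ((e : ℤ) + 1).toNat = e + 1 := by omega
    simp [this, Nat.choose_succ_succ]

theorem intChoose_eq_zero {y : ℕ} {d : ℤ} (h : d < 0 ∨ y < d) : intChoose y d = 0 := by
  unfold intChoose
  split_ifs with h0
  · rw [Nat.choose_eq_zero_of_lt (by omega), Nat.cast_zero]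
  · rfl

/-- The lattice path matrix from the positions `u` at height `y` to the positions `s` at
height `0`. -/
def pathMatrix (y : ℕ) (s u : Fin n → ℤ) : Matrix (Fin n) (Fin n) ℤ :=
  Matrix.of fun k l => intChoose y (s l - u k)

theorem det_pathMatrix_succ (y : ℕ) (s u : Fin n → ℤ) :
    (pathMatrix (y + 1) s u).det = ∑ ε : Finset (Fin n), (pathMatrix y s (shift u ε)).det := by
  have h : pathMatrix (y + 1) s u =
      (fun k l => intChoose y (s l - (u k + 1))) + fun k l => intChoose y (s l - u k) := by
    ext k l
    simp only [pathMatrix, Matrix.of_apply, intChoose_succ, Pi.add_apply, sub_add_eq_sub_sub]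
  rw [h]
  refine (Matrix.detRowAlternating.map_add_univ _ _).trans ?_
  refine Finset.sum_congr rfl fun ε _ => congrArg _ ?_
  ext k l
  by_cases hk : k ∈ ε <;> simp [pathMatrix, shift, hk]

theorem det_pathMatrix_zero {s : Fin n → ℤ} (hs : Function.Injective s) :
    (pathMatrix 0 s s).det = 1 := by
  have : pathMatrix 0 s s = 1 := by
    ext k l
    rcases eq_or_ne k l with rfl | hkl
    · simp [pathMatrix, intChoose]
    · rw [Matrix.one_apply_ne hkl]
      have := hs.ne hkl
      exact intChoose_eq_zero (by push_cast; omega)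
  rw [this, Matrix.det_one]

theorem shift_monotone {u : Fin n → ℤ} (hu : StrictMono u) (ε : Finset (Fin n)) :
    Monotone (shift u ε) := by
  intro k l hkl
  rcases hkl.eq_or_lt with rfl | hkl
  · exact le_rfl
  · have := hu hkl
    unfold shift
    split_ifs <;> omega

/-- Tilings of a strip are counted by the determinant of the lattice path matrix. -/
theorem M_strip_eq_det {E : ℤ → Set ℤ} (hE : ∀ z, (E z).Finite) {s : Fin n → ℤ}
    (hs : StrictMono s) (hE0 : E 0 = Set.range s) {T : ℤ}
    (hT : ∀ (y : ℕ) (x : ℤ), x ≤ T - y → 0 ≤ x → x ∉ E y → ∀ l, intChoose y (s l - x) = 0)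
    (y : ℕ) {u : Fin n → ℤ} (hu : StrictMono u) (h0 : ∀ k, 0 ≤ u k) (h1 : ∀ k, u k ≤ T - y)
    (hy : y = 0 → Set.range u = Set.range s) :
    (M (strip E y u) : ℤ) = (pathMatrix y s u).det := by
  classical
  induction y generalizing u with
  | zero =>
    obtain rfl : u = s := hu.range_inj hs |>.1 (hy rfl)
    rw [strip_zero, M_empty, det_pathMatrix_zero hu.injective, Nat.cast_one]
  | succ y ih =>
    rw [M_strip_succ hE y hu.injective, det_pathMatrix_succ, Nat.cast_sum, Finset.sum_filter]
    refine Finset.sum_congr rfl fun ε _ => ?_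
    have h0' (k) : 0 ≤ shift u ε k := by
      have := h0 k
      unfold shift
      split_ifs <;> omega
    have h1' (k) : shift u ε k ≤ T - y := by
      have := h1 k
      unfold shift
      push_cast at this
      split_ifs <;> omega
    split_ifs with hε
    · refine ih ((shift_monotone hu ε).strictMono_of_injective hε.1) h0' h1' ?_
      rintro rfl
      rw [← hE0]
      exact hε.2.1.antisymm (hε.2.2 rfl)
    · symm
      by_cases hi : Function.Injective (shift u ε)
      · by_cases hr : Set.range (shift u ε) ⊆ E y
        · refine (hε ⟨hi, hr, ?_⟩).elim
          rintro rfl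
          rw [Nat.cast_zero, hE0] at hr
          rw [hE0]
          refine (Set.eq_of_subset_of_ncard_le hr ?_ (Set.finite_range s)).symm.subset
          rw [← Set.image_univ, ← Set.image_univ, Set.ncard_image_of_injective _ hi,
            Set.ncard_image_of_injective _ hs.injective]
        · obtain ⟨_, ⟨k, rfl⟩, hk⟩ := Set.not_subset.1 hr
          exact Matrix.det_eq_zero_of_row_eq_zero k fun l => hT y _ (h1' k) (h0' k) hk l
      · simp only [Function.Injective, not_forall] at hi
        obtain ⟨k, l, hkl, hne⟩ := hi
        refine Matrix.det_zero_of_row_eq hne ?_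
        ext m
        simp [pathMatrix, hkl]

end Strip

theorem Fin.range_succAbove_cast {n : ℕ} (p : Fin (n + 1)) (r : ℤ) :
    (Set.range fun k : Fin n => r + ((p.succAbove k : ℕ) : ℤ)) =
      {x | r ≤ x ∧ x ≤ r + n ∧ x ≠ r + p} := by
  ext x
  constructor
  · rintro ⟨k, rfl⟩
    have h1 := (p.succAbove k).2
    have h2 := Fin.val_ne_of_ne (p.succAbove_ne k)
    refine ⟨?_, ?_, ?_⟩ <;> simp only <;> omega
  · rintro ⟨h1, h2, h3⟩
    have hx : (x - r).toNat < n + 1 := by omega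
    have hne : (⟨(x - r).toNat, hx⟩ : Fin (n + 1)) ≠ p := by
      rintro rfl
      apply h3
      simp only
      omega
    obtain ⟨k, hk⟩ := Fin.exists_succAbove_eq hne
    refine ⟨k, ?_⟩
    simp only [hk]
    omega

theorem OPP_eq_det {n b c : ℕ} (hbc : 1 ≤ b + c) (p q : Fin (n + 1)) :
    (OPP (n + 1) b c (p + 1) (q + 1) : ℤ) = (pathMatrix (b + c)
      (fun l => (b : ℤ) + ((p.succAbove l : ℕ) : ℤ))
      (fun k => 0 + ((q.succAbove k : ℕ) : ℤ))).det := by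
  have hmono (p : Fin (n + 1)) (r : ℤ) :
      StrictMono fun k : Fin n => r + ((p.succAbove k : ℕ) : ℤ) := fun k l h => by
    have : (p.succAbove k : ℕ) < p.succAbove l := Fin.strictMono_succAbove p h
    simp only
    omega
  let s : Fin n → ℤ := fun l => (b : ℤ) + ((p.succAbove l : ℕ) : ℤ)
  let E : ℤ → Set ℤ := fun z => if z = 0 then Set.range s else
    {x | 0 ≤ x ∧ b - z ≤ x ∧ x ≤ n + b ∧ x ≤ n + b + c - z}
  have hq (k) : ((q.succAbove k : ℕ) : ℤ) ≤ n := by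
    have := (q.succAbove k).2
    omega
  have hp (k) : ((p.succAbove k : ℕ) : ℤ) ≤ n := by
    have := (p.succAbove k).2
    omega
  have hfin (z : ℤ) : (E z).Finite := by
    by_cases hz : z = 0
    · simp only [E, if_pos hz]
      exact Set.finite_range s
    · simp only [E, if_neg hz]
      exact (Set.finite_Icc (0 : ℤ) (n + b)).subset fun x hx => ⟨hx.1, hx.2.2.1⟩
  have hT (y : ℕ) (x : ℤ) (hxT : x ≤ n + b + c - y) (hx0 : 0 ≤ x) (hx : x ∉ E y) (l : Fin n) :
      intChoose y (s l - x) = 0 := by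
    apply intChoose_eq_zero
    have hl := hp l
    have hs : s l = b + ((p.succAbove l : ℕ) : ℤ) := rfl
    rcases Nat.eq_zero_or_pos y with rfl | hy
    · simp only [E, Nat.cast_zero, if_true, Set.mem_range, not_exists] at hx
      have := hx l
      push_cast
      omega
    · simp only [E, if_neg (by omega : (y : ℤ) ≠ 0), Set.mem_ofPred_eq] at hx
      omega
  rw [← M_strip_eq_det hfin (hmono p b) (if_pos rfl) hT (b + c) (hmono q 0) (fun k => by positivity)
    (fun k => by have := hq k; push_cast; omega) (by omega), OPP]
  congr 2
  have hE0 : E 0 = Set.range s := if_pos rfl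
  have hE {z : ℤ} (hz : z ≠ 0) :
    E z = {x | 0 ≤ x ∧ b - z ≤ x ∧ x ≤ n + b ∧ x ≤ n + b + c - z} := if_neg hz
  ext ⟨x, z, _ | _⟩
  · simp only [Hex, HexK, strip, Fin.range_succAbove_cast, Set.mem_sdiff, Set.mem_ofPred_eq,
      Set.mem_insert_iff, Set.mem_singleton_iff, Prod.mk.injEq, Bool.false_eq_true, if_false,
      and_false, and_true, false_or]
    push_cast
    by_cases hz : 0 ≤ z
    · rw [hE (by omega : z + 1 ≠ 0), Set.mem_ofPred_eq]
      omega
    · omega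
  · simp only [Hex, HexK, strip, Set.mem_sdiff, Set.mem_ofPred_eq,
      Set.mem_insert_iff, Set.mem_singleton_iff, Prod.mk.injEq, Bool.true_eq_false, if_true,
      and_false, and_true, or_false]
    push_cast
    by_cases hz : z = 0
    · subst hz
      rw [hE0, Fin.range_succAbove_cast, Set.mem_ofPred_eq]
      omega
    · rw [hE hz, Set.mem_ofPred_eq]
      omega

/-- Kuo's condensation recurrence for `OPP(a,b,c)_{i,j}`. -/
theorem opp_recurrence (a b c i j : ℕ) (ha : 3 ≤ a) (hb : 1 ≤ b) (hc : 1 ≤ c)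
    (hi1 : 2 ≤ i) (hi2 : i ≤ a - 1) (hj1 : 2 ≤ j) (hj2 : j ≤ a - 1) :
    (OPP a b c i j : ℤ) * OPP (a - 2) b c (i - 1) (j - 1) =
      (OPP (a - 1) b c (i - 1) (j - 1) : ℤ) * OPP (a - 1) b c i j -
        (OPP (a - 1) (b - 1) (c + 1) i (j - 1) : ℤ) * OPP (a - 1) (b + 1) (c - 1) (i - 1) j := by
  obtain ⟨m, rfl⟩ : ∃ m, a = m + 3 := ⟨a - 3, by omega⟩
  obtain ⟨i, rfl⟩ : ∃ k, i = k + 2 := ⟨i - 2, by omega⟩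
  obtain ⟨j, rfl⟩ : ∃ k, j = k + 2 := ⟨j - 2, by omega⟩
  obtain ⟨b, rfl⟩ : ∃ k, b = k + 1 := ⟨b - 1, by omega⟩
  obtain ⟨c, rfl⟩ : ∃ k, c = k + 1 := ⟨c - 1, by omega⟩
  have hi : i < m + 1 := by omega
  have hj : j < m + 1 := by omega
  have h0 := OPP_eq_det (n := m + 2) (b := b + 1) (c := c + 1) (by omega)
    ⟨i + 1, by omega⟩ ⟨j + 1, by omega⟩
  have h1 := OPP_eq_det (n := m) (b := b + 1) (c := c + 1) (by omega) ⟨i, hi⟩ ⟨j, hj⟩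
  have h2 := OPP_eq_det (n := m + 1) (b := b + 1) (c := c + 1) (by omega)
    ⟨i, by omega⟩ ⟨j, by omega⟩
  have h3 := OPP_eq_det (n := m + 1) (b := b + 1) (c := c + 1) (by omega)
    ⟨i + 1, by omega⟩ ⟨j + 1, by omega⟩
  have h4 := OPP_eq_det (n := m + 1) (b := b) (c := c + 1 + 1) (by omega)
    ⟨i + 1, by omega⟩ ⟨j, by omega⟩
  have h5 := OPP_eq_det (n := m + 1) (b := b + 1 + 1) (c := c) (by omega)
    ⟨i, by omega⟩ ⟨j + 1, by omega⟩
  have hN4 : b + (c + 1 + 1) = b + 1 + (c + 1) := by omega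
  have hN5 : b + 1 + 1 + c = b + 1 + (c + 1) := by omega
  rw [hN4] at h4
  rw [hN5] at h5
  change (OPP (m + 2 + 1) (b + 1) (c + 1) (i + 1 + 1) (j + 1 + 1) : ℤ) *
    OPP (m + 1) (b + 1) (c + 1) (i + 1) (j + 1) =
    (OPP (m + 1 + 1) (b + 1) (c + 1) (i + 1) (j + 1) : ℤ) *
      OPP (m + 1 + 1) (b + 1) (c + 1) (i + 1 + 1) (j + 1 + 1) -
    (OPP (m + 1 + 1) b (c + 1 + 1) (i + 1 + 1) (j + 1) : ℤ) *
      OPP (m + 1 + 1) (b + 1 + 1) c (i + 1) (j + 1 + 1)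
  rw [h0, h1, h2, h3, h4, h5]
  have hv (n : ℕ) (p : Fin (n + 1)) (k : Fin n) :
      ((p.succAbove k : ℕ) : ℤ) = if (k : ℕ) < p then (k : ℤ) else k + 1 := by
    simp only [Fin.succAbove, Fin.lt_def, Fin.val_castSucc]
    split_ifs <;> simp
  have hdj := Matrix.desnanot_jacobi (pathMatrix (b + 1 + (c + 1))
    (fun l => ((b + 1 : ℕ) : ℤ) + (((⟨i + 1, by omega⟩ : Fin (m + 3)).succAbove l : ℕ) : ℤ))
    (fun k => 0 + (((⟨j + 1, by omega⟩ : Fin (m + 3)).succAbove k : ℕ) : ℤ)))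
  convert hdj using 4 <;>
  · ext k l
    simp only [pathMatrix, Matrix.submatrix_apply, Matrix.of_apply, hv, Fin.val_succ,
      Fin.val_castSucc] <;>
    · refine congrArg _ ?_
      push_cast
      split_ifs <;> omega
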